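/- Let n ≥ 1, s > 0, ε > 0 and ν ∈ ℕ. Then there exists q > 0 such that for every multi-index α ∈ ℕⁿ, every multi-index β with |β| ≤ ν, and every x ∈ ℝⁿ, one has |∂^β( x^α e^{−ε⟨x⟩^{1/s}} )(x)| ≤ q^{|α|+1} (α!)^s. -/

import Mathlib

open Finset
open scoped Real Nat

noncomputable section

abbrev Euc (n : ℕ) := EuclideanSpace ℝ (Fin n)

/-- Japanese bracket `⟨x⟩ = (1+|x|²)^{1/2}`. -/
def jap {n : ℕ} (x : Euc n) : ℝ := Real.sqrt (1 + ‖x‖ ^ 2)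

/-- Length `|α|` of a multi-index. -/
def deg {n : ℕ} (α : Fin n → ℕ) : ℕ := ∑ i, α i

/-- Factorial `α!` of a multi-index. -/
def mfact {n : ℕ} (α : Fin n → ℕ) : ℕ := ∏ i, (α i)!

/-- First-order partial derivative in the `j`-th coordinate direction. -/
def pd {n : ℕ} {F : Type*} [NormedAddCommGroup F] [NormedSpace ℝ F]
    (j : Fin n) (f : Euc n → F) : Euc n → F :=
  fun x => fderiv ℝ f x (EuclideanSpace.single j 1)

/-- Multi-index partial derivative `∂^β = ∂₁^{β₁} ⋯ ∂ₙ^{βₙ}`. -/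
def pdM {n : ℕ} {F : Type*} [NormedAddCommGroup F] [NormedSpace ℝ F]
    (β : Fin n → ℕ) (f : Euc n → F) : Euc n → F :=
  ((List.ofFn fun j : Fin n => (pd j)^[β j]).foldr (· ∘ ·) id) f

end

open scoped ContDiff

/-- The function `y ↦ y^α ⟨y⟩^t e^{-ε⟨y⟩^{1/s}}`. -/
noncomputable def monoJapExp {n : ℕ} (s ε : ℝ) (α : Fin n → ℕ) (t : ℝ) (y : Euc n) : ℝ :=
  (∏ i, y i ^ α i) * (jap y ^ t * Real.exp (-ε * jap y ^ (1 / s)))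

/-- Successive partial derivatives in the directions listed in `L`, the last one first. -/
noncomputable def pdList {n : ℕ} (L : List (Fin n)) (f : Euc n → ℝ) : Euc n → ℝ :=
  L.foldr (fun j g => pd j g) f

section Jap

variable {n : ℕ}

lemma one_le_jap (x : Euc n) : 1 ≤ jap x :=
  Real.one_le_sqrt.2 (by nlinarith [sq_nonneg ‖x‖])

lemma jap_pos (x : Euc n) : 0 < jap x := one_pos.trans_le (one_le_jap x)

lemma abs_apply_le_jap (x : Euc n) (i : Fin n) : |x i| ≤ jap x := by
  have h : |x i| ≤ ‖x‖ := by simpa using PiLp.norm_apply_le x i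
  exact h.trans (Real.le_sqrt_of_sq_le (by linarith))

lemma contDiff_jap : ContDiff ℝ ∞ (jap (n := n)) := by
  unfold jap
  refine ContDiff.sqrt (contDiff_const.add (contDiff_norm_sq ℝ)) fun x => ?_
  positivity

lemma pd_jap (j : Fin n) (x : Euc n) :
    HasFDerivAt jap (fderiv ℝ jap x) x ∧
      fderiv ℝ jap x (EuclideanSpace.single j 1) = x j / jap x := by
  have h0 : (1 + ‖x‖ ^ 2) ≠ 0 := by positivity
  have h := (((hasStrictFDerivAt_norm_sq x).hasFDerivAt).const_add 1).sqrt h0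
  have h' : HasFDerivAt jap _ x := h
  refine ⟨h'.differentiableAt.hasFDerivAt, ?_⟩
  rw [h'.fderiv]
  have hj := jap_pos x
  simp [jap, EuclideanSpace.inner_single_right] at hj ⊢
  field_simp

end Jap

section PartialDerivatives

variable {n : ℕ}

lemma contDiff_pd (j : Fin n) {f : Euc n → ℝ} (hf : ContDiff ℝ ∞ f) :
    ContDiff ℝ ∞ (pd j f) := by
  unfold pd
  exact (hf.fderiv_right (m := ∞) (by simp)).clm_apply contDiff_const

lemma contDiff_pdList (L : List (Fin n)) {f : Euc n → ℝ} (hf : ContDiff ℝ ∞ f) :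
    ContDiff ℝ ∞ (pdList L f) := by
  induction L with
  | nil => exact hf
  | cons j L ih => exact contDiff_pd j ih

lemma pdList_add (L : List (Fin n)) {f g : Euc n → ℝ} (hf : ContDiff ℝ ∞ f)
    (hg : ContDiff ℝ ∞ g) : pdList L (f + g) = pdList L f + pdList L g := by
  induction L with
  | nil => rfl
  | cons j L ih =>
    change pd j (pdList L (f + g)) = pd j (pdList L f) + pd j (pdList L g)
    rw [ih]
    ext x
    have h1 := (contDiff_pdList L hf).differentiable (by simp) x
    have h2 := (contDiff_pdList L hg).differentiable (by simp) x
    simp [pd, fderiv_add h1 h2]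

lemma pdList_smul (L : List (Fin n)) (c : ℝ) {f : Euc n → ℝ} (hf : ContDiff ℝ ∞ f) :
    pdList L (c • f) = c • pdList L f := by
  induction L with
  | nil => rfl
  | cons j L ih =>
    change pd j (pdList L (c • f)) = c • pd j (pdList L f)
    rw [ih]
    ext x
    have h1 := (contDiff_pdList L hf).differentiable (by simp) x
    simp [pd, fderiv_const_smul h1]

lemma pdList_append (L M : List (Fin n)) (f : Euc n → ℝ) :
    pdList (L ++ M) f = pdList L (pdList M f) :=
  List.foldr_append

lemma pdList_replicate (m : ℕ) (j : Fin n) (f : Euc n → ℝ) :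
    pdList (List.replicate m j) f = (pd j)^[m] f := by
  induction m with
  | zero => rfl
  | succ m ih =>
    rw [Function.iterate_succ_apply', ← ih]
    rfl

lemma exists_pdM_eq_pdList (β : Fin n → ℕ) :
    ∃ L : List (Fin n), L.length = deg β ∧ ∀ f : Euc n → ℝ, pdM β f = pdList L f := by
  refine ⟨(List.finRange n).flatMap fun j => List.replicate (β j) j, ?_, fun f => ?_⟩
  · simp [List.length_flatMap, deg, ← List.ofFn_eq_map, List.sum_ofFn]
  · rw [pdM, List.ofFn_eq_map]
    induction List.finRange n with
    | nil => rfl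
    | cons j M ih =>
      rw [List.flatMap_cons, pdList_append, ← ih, pdList_replicate]
      rfl

end PartialDerivatives

section Monomials

variable {n : ℕ}

lemma contDiff_monoJapExp (s ε : ℝ) (α : Fin n → ℕ) (t : ℝ) :
    ContDiff ℝ ∞ (monoJapExp s ε α t) := by
  have hr : ∀ r : ℝ, ContDiff ℝ ∞ fun y : Euc n => jap y ^ r := fun r =>
    contDiff_jap.rpow_const_of_ne fun x => (jap_pos x).ne'
  unfold monoJapExp
  refine ContDiff.mul ?_ ((hr t).mul (contDiff_const.mul (hr _)).exp)
  exact contDiff_prod fun i _ => by fun_prop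

lemma pd_monomial (α : Fin n → ℕ) (j : Fin n) (x : Euc n) :
    fderiv ℝ (fun y : Euc n => ∏ i, y i ^ α i) x (EuclideanSpace.single j 1) =
      α j * ∏ i, x i ^ Function.update α j (α j - 1) i := by
  have h : ∀ i ∈ (univ : Finset (Fin n)), HasFDerivAt (fun y : Euc n => y i ^ α i)
      ((α i * x i ^ (α i - 1)) • (EuclideanSpace.proj i : Euc n →L[ℝ] ℝ)) x := fun i _ => by
    have := (EuclideanSpace.proj i : Euc n →L[ℝ] ℝ).hasFDerivAt (x := x)
    simpa using this.pow (α i)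
  rw [(HasFDerivAt.finsetProd h).fderiv, ← Finset.mul_prod_erase univ _ (mem_univ j),
    _root_.sum_apply, Finset.sum_eq_single j]
  · have : ∏ i ∈ univ.erase j, x i ^ Function.update α j (α j - 1) i =
        ∏ i ∈ univ.erase j, x i ^ α i :=
      Finset.prod_congr rfl fun i hi => by
        rw [Function.update_of_ne (Finset.ne_of_mem_erase hi)]
    rw [this]
    simp
    ring
  · intro i _ hij
    simp [hij]
  · simp

lemma prod_update_succ (α : Fin n → ℕ) (j : Fin n) (x : Euc n) :
    ∏ i, x i ^ Function.update α j (α j + 1) i = x j * ∏ i, x i ^ α i := by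
  rw [← Finset.mul_prod_erase univ _ (mem_univ j),
    ← Finset.mul_prod_erase univ (fun i => x i ^ α i) (mem_univ j)]
  have : ∏ i ∈ univ.erase j, x i ^ Function.update α j (α j + 1) i =
      ∏ i ∈ univ.erase j, x i ^ α i :=
    Finset.prod_congr rfl fun i hi => by
      rw [Function.update_of_ne (Finset.ne_of_mem_erase hi)]
  rw [this, Function.update_self, pow_succ]
  ring

lemma pd_monoJapExp (s ε : ℝ) (α : Fin n → ℕ) (t : ℝ) (j : Fin n) :
    pd j (monoJapExp s ε α t) =
      (α j : ℝ) • monoJapExp s ε (Function.update α j (α j - 1)) t +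
      (t • monoJapExp s ε (Function.update α j (α j + 1)) (t - 2) +
      (-(ε / s)) • monoJapExp s ε (Function.update α j (α j + 1)) (t + 1 / s - 2)) := by
  ext x
  have hJ := jap_pos x
  obtain ⟨h, hj⟩ := pd_jap j x
  have hm : HasFDerivAt (fun y : Euc n => ∏ i, y i ^ α i)
      (fderiv ℝ (fun y : Euc n => ∏ i, y i ^ α i) x) x := by
    refine DifferentiableAt.hasFDerivAt ?_
    exact (contDiff_prod (n := 1) fun i _ => by fun_prop).differentiable (by simp) x
  have hr : ∀ r : ℝ, HasFDerivAt (fun y : Euc n => jap y ^ r)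
      ((r * jap x ^ (r - 1)) • fderiv ℝ jap x) x := fun r =>
    h.rpow_const (Or.inl hJ.ne')
  have key := hm.mul ((hr t).mul ((hr (1 / s)).const_mul (-ε)).exp)
  have e1 : jap x ^ (t - 1) = jap x ^ (t - 2) * jap x := by
    rw [← Real.rpow_add_one hJ.ne']; ring_nf
  have e2 : jap x ^ (t + 1 / s - 2) * jap x * jap x = jap x ^ t * jap x ^ (1 / s) := by
    rw [← Real.rpow_add_one hJ.ne', ← Real.rpow_add_one hJ.ne', ← Real.rpow_add hJ]; ring_nf
  have e3 : jap x ^ (1 / s - 1) * jap x = jap x ^ (1 / s) := by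
    rw [← Real.rpow_add_one hJ.ne']; ring_nf
  have e4 : jap x ^ t * jap x ^ (1 / s - 1) = jap x ^ (t + 1 / s - 2) * jap x := by
    apply mul_right_cancel₀ hJ.ne'
    rw [e2, mul_assoc, e3]
  have key' : HasFDerivAt (monoJapExp s ε α t) _ x := key
  rw [pd, key'.fderiv]
  simp only [add_apply, smul_apply, smul_eq_mul, hj,
    pd_monomial, Pi.add_apply, Pi.smul_apply, Pi.mul_apply, monoJapExp, prod_update_succ, e1]
  generalize jap x ^ (t + 1 / s - 2) = A at e4 ⊢
  generalize jap x ^ (1 / s - 1) = B at e4 ⊢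
  generalize Real.exp _ = E
  field_simp
  linear_combination (-(∏ i, x i ^ α i) * E * ε * x j / s) * e4

end Monomials

section Bounds

variable {n : ℕ}

lemma pow_le_factorial_mul_exp {J s δ : ℝ} (hJ : 0 < J) (hs : 0 < s) (hδ : 0 < δ) (m : ℕ) :
    J ^ m ≤ ((δ⁻¹) ^ s) ^ m * (m ! : ℝ) ^ s * Real.exp (s * δ * J ^ (1 / s)) := by
  have hw : 0 < J ^ (1 / s) := Real.rpow_pos_of_pos hJ _
  have h := Real.pow_div_factorial_le_exp (δ * J ^ (1 / s)) (by positivity) m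
  have hf : (0 : ℝ) < m ! := by positivity
  rw [div_le_iff₀ hf, mul_pow] at h
  have h2 : (J ^ (1 / s)) ^ m ≤ δ⁻¹ ^ m * m ! * Real.exp (δ * J ^ (1 / s)) := by
    rw [inv_pow, mul_assoc, ← div_eq_inv_mul, le_div_iff₀ (by positivity)]
    linarith
  have h3 := Real.rpow_le_rpow (by positivity) h2 hs.le
  rw [Real.mul_rpow (by positivity) (by positivity), Real.mul_rpow (by positivity) hf.le,
    ← Real.exp_mul, ← Real.rpow_natCast (J ^ (1 / s)), ← Real.rpow_mul hJ.le,
    ← Real.rpow_mul hJ.le, ← Real.rpow_natCast δ⁻¹, ← Real.rpow_mul (by positivity)] at h3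
  rw [← Real.rpow_natCast (δ⁻¹ ^ s), ← Real.rpow_mul (by positivity), ← Real.rpow_natCast J]
  convert h3 using 2
  · field_simp
  · ring_nf
  · ring_nf

lemma exists_bound_monoJapExp (n : ℕ) {s ε : ℝ} (hs : 0 < s) (hε : 0 < ε) (t : ℝ) :
    ∃ q : ℝ, 1 ≤ q ∧ ∀ (α : Fin n → ℕ) (x : Euc n),
      |monoJapExp s ε α t x| ≤ q ^ (deg α + 1) * (mfact α : ℝ) ^ s := by
  set δ : ℝ := ε / ((n + 1) * s) with hδ
  have hδ0 : 0 < δ := by positivity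
  set N := ⌈t⌉₊
  set a : ℝ := δ⁻¹ ^ s
  have ha : 0 < a := by positivity
  set b : ℝ := a ^ N * (N ! : ℝ) ^ s
  have hb : 0 < b := by positivity
  refine ⟨a + b + 1, by linarith, fun α x => ?_⟩
  have hJ := jap_pos x
  set E := Real.exp (s * δ * jap x ^ (1 / s)) with hE
  have hE0 : 0 < E := Real.exp_pos _
  have h1 : |∏ i, x i ^ α i| ≤ a ^ deg α * (mfact α : ℝ) ^ s * E ^ n := by
    rw [Finset.abs_prod]
    calc ∏ i, |x i ^ α i| ≤ ∏ i, (a ^ α i * ((α i)! : ℝ) ^ s * E) := by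
          refine Finset.prod_le_prod (fun _ _ => abs_nonneg _) fun i _ => ?_
          rw [abs_pow]
          exact (pow_le_pow_left₀ (abs_nonneg _) (abs_apply_le_jap x i) _).trans
            (pow_le_factorial_mul_exp hJ hs hδ0 _)
      _ = _ := by
          rw [Finset.prod_mul_distrib, Finset.prod_mul_distrib, Finset.prod_pow_eq_pow_sum,
            Real.finsetProd_rpow _ _ fun _ _ => by positivity]
          simp [deg, mfact]
  have h2 : jap x ^ t ≤ b * E := by
    calc jap x ^ t ≤ jap x ^ (N : ℝ) :=
          Real.rpow_le_rpow_of_exponent_le (one_le_jap x) (Nat.le_ceil t)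
      _ = jap x ^ N := Real.rpow_natCast _ _
      _ ≤ _ := pow_le_factorial_mul_exp hJ hs hδ0 _
  have h3 : E ^ n * E * Real.exp (-ε * jap x ^ (1 / s)) = 1 := by
    rw [← pow_succ, hE, ← Real.exp_nat_mul, ← Real.exp_add, Real.exp_eq_one_iff, hδ]
    push_cast
    field_simp
    ring
  have hM : (0 : ℝ) ≤ (mfact α : ℝ) ^ s := by positivity
  calc |monoJapExp s ε α t x|
      = |∏ i, x i ^ α i| * (jap x ^ t * Real.exp (-ε * jap x ^ (1 / s))) := by
        rw [monoJapExp, abs_mul, abs_of_pos (a := jap x ^ t * _) (by positivity)]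
    _ ≤ (a ^ deg α * (mfact α : ℝ) ^ s * E ^ n) *
          ((b * E) * Real.exp (-ε * jap x ^ (1 / s))) := by gcongr
    _ = a ^ deg α * b * (mfact α : ℝ) ^ s * (E ^ n * E * Real.exp (-ε * jap x ^ (1 / s))) := by
        ring
    _ = a ^ deg α * b * (mfact α : ℝ) ^ s := by rw [h3, mul_one]
    _ ≤ (a + b + 1) ^ deg α * (a + b + 1) * (mfact α : ℝ) ^ s := by
        gcongr <;> linarith
    _ = _ := by rw [pow_succ]

lemma deg_update (α : Fin n → ℕ) (j : Fin n) (m : ℕ) :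
    deg (Function.update α j m) + α j = deg α + m := by
  unfold deg
  rw [← Finset.add_sum_erase univ _ (mem_univ j), ← Finset.add_sum_erase univ α (mem_univ j)]
  have : ∑ i ∈ univ.erase j, Function.update α j m i = ∑ i ∈ univ.erase j, α i :=
    Finset.sum_congr rfl fun i hi => by rw [Function.update_of_ne (Finset.ne_of_mem_erase hi)]
  rw [this, Function.update_self]
  ring

lemma mfact_update_le (α : Fin n → ℕ) (j : Fin n) :
    mfact (Function.update α j (α j - 1)) ≤ mfact α := by
  refine Finset.prod_le_prod' fun i _ => Nat.factorial_le ?_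
  obtain rfl | h := eq_or_ne i j
  · simp
  · rw [Function.update_of_ne h]

lemma mfact_update_succ (α : Fin n → ℕ) (j : Fin n) :
    mfact (Function.update α j (α j + 1)) = (α j + 1) * mfact α := by
  unfold mfact
  rw [← Finset.mul_prod_erase univ _ (mem_univ j),
    ← Finset.mul_prod_erase univ (fun i => (α i)!) (mem_univ j)]
  have : ∏ i ∈ univ.erase j, (Function.update α j (α j + 1) i)! = ∏ i ∈ univ.erase j, (α i)! :=
    Finset.prod_congr rfl fun i hi => by rw [Function.update_of_ne (Finset.ne_of_mem_erase hi)]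
  rw [this, Function.update_self, Nat.factorial_succ, mul_assoc]

lemma apply_succ_le_two_pow (α : Fin n → ℕ) (j : Fin n) : α j + 1 ≤ 2 ^ (deg α + 1) := by
  have h : α j ≤ deg α := Finset.single_le_sum (f := α) (fun _ _ => Nat.zero_le _) (mem_univ j)
  have := (deg α + 1).lt_two_pow_self
  omega

lemma raised_bound {s q c : ℝ} (hs : 0 < s) (hq : 1 ≤ q) (α : Fin n → ℕ) (j : Fin n) :
    |c| * (q ^ (deg (Function.update α j (α j + 1)) + 1) *
      (mfact (Function.update α j (α j + 1)) : ℝ) ^ s) ≤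
      ((1 + |c|) * q ^ 2 * 2 ^ s) ^ (deg α + 1) * (mfact α : ℝ) ^ s := by
  have hd := deg_update α j (α j + 1)
  have hd' : deg (Function.update α j (α j + 1)) = deg α + 1 := by omega
  have h2 : ((α j : ℝ) + 1) ^ s ≤ (2 ^ s) ^ (deg α + 1) := by
    rw [← Real.rpow_natCast, ← Real.rpow_mul (by norm_num), mul_comm s, Real.rpow_mul (by norm_num),
      Real.rpow_natCast]
    exact Real.rpow_le_rpow (by positivity) (by exact_mod_cast apply_succ_le_two_pow α j) hs.le
  have h3 : q ^ (deg α + 1 + 1) ≤ (q ^ 2) ^ (deg α + 1) := by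
    rw [← pow_mul]
    exact pow_le_pow_right₀ hq (by omega)
  have h4 : |c| ≤ (1 + |c|) ^ (deg α + 1) :=
    (by linarith : |c| ≤ 1 + |c|).trans
      (le_self_pow₀ (by linarith [abs_nonneg c]) (Nat.succ_ne_zero _))
  rw [hd', mfact_update_succ, Nat.cast_mul, Real.mul_rpow (by positivity) (by positivity), mul_pow,
    mul_pow]
  push_cast
  calc |c| * (q ^ (deg α + 1 + 1) * (((α j : ℝ) + 1) ^ s * (mfact α : ℝ) ^ s))
      ≤ (1 + |c|) ^ (deg α + 1) * ((q ^ 2) ^ (deg α + 1) *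
        ((2 ^ s) ^ (deg α + 1) * (mfact α : ℝ) ^ s)) := by gcongr
    _ = _ := by ring

lemma lowered_bound {s q : ℝ} (hs : 0 < s) (hq : 1 ≤ q) (α : Fin n → ℕ) (j : Fin n) :
    (α j : ℝ) * (q ^ (deg (Function.update α j (α j - 1)) + 1) *
      (mfact (Function.update α j (α j - 1)) : ℝ) ^ s) ≤
      (2 * q) ^ (deg α + 1) * (mfact α : ℝ) ^ s := by
  have hd := deg_update α j (α j - 1)
  have hd' : deg (Function.update α j (α j - 1)) + 1 ≤ deg α + 1 := by omega
  have h1 : (α j : ℝ) ≤ 2 ^ (deg α + 1) := by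
    exact_mod_cast (Nat.le_succ _).trans (apply_succ_le_two_pow α j)
  have h2 : (mfact (Function.update α j (α j - 1)) : ℝ) ≤ mfact α := by
    exact_mod_cast mfact_update_le α j
  rw [mul_pow, mul_assoc]
  gcongr

lemma exists_bound_pdList (n : ℕ) {s ε : ℝ} (hs : 0 < s) (hε : 0 < ε) (k : ℕ) :
    ∀ t : ℝ, ∃ q : ℝ, 1 ≤ q ∧ ∀ L : List (Fin n), L.length = k → ∀ (α : Fin n → ℕ) (x : Euc n),
      |pdList L (monoJapExp s ε α t) x| ≤ q ^ (deg α + 1) * (mfact α : ℝ) ^ s := by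
  induction k with
  | zero =>
    intro t
    obtain ⟨q, hq, h⟩ := exists_bound_monoJapExp n hs hε t
    refine ⟨q, hq, fun L hL α x => ?_⟩
    rw [List.eq_nil_of_length_eq_zero hL]
    exact h α x
  | succ k ih =>
    intro t
    obtain ⟨q₁, hq₁, h₁⟩ := ih t
    obtain ⟨q₂, hq₂, h₂⟩ := ih (t - 2)
    obtain ⟨q₃, hq₃, h₃⟩ := ih (t + 1 / s - 2)
    set a := 2 * q₁ with ha
    set b := (1 + |t|) * q₂ ^ 2 * 2 ^ s with hb
    set c := (1 + |-(ε / s)|) * q₃ ^ 2 * 2 ^ s with hc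
    have ha0 : 1 ≤ a := by linarith
    have hb0 : 0 ≤ b := by positivity
    have hc0 : 0 ≤ c := by positivity
    refine ⟨a + (b + c), by linarith, fun L hL α x => ?_⟩
    obtain rfl | ⟨L, j, rfl⟩ := L.eq_nil_or_concat'
    · simp at hL
    have hL' : L.length = k := by simpa using hL
    have hpd : pdList [j] (monoJapExp s ε α t) = pd j (monoJapExp s ε α t) := rfl
    have hsm : ∀ (r : ℝ) (γ : Fin n → ℕ) (u : ℝ), ContDiff ℝ ∞ (r • monoJapExp s ε γ u) :=
      fun r γ u => (contDiff_monoJapExp s ε γ u).const_smul r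
    have hadd : ∀ {f g : Euc n → ℝ}, ContDiff ℝ ∞ f → ContDiff ℝ ∞ g → ContDiff ℝ ∞ (f + g) :=
      fun hf hg => hf.add hg
    rw [pdList_append, hpd, pd_monoJapExp, pdList_add L (hsm _ _ _) (hadd (hsm _ _ _) (hsm _ _ _)),
      pdList_add L (hsm _ _ _) (hsm _ _ _), pdList_smul L _ (contDiff_monoJapExp _ _ _ _),
      pdList_smul L _ (contDiff_monoJapExp _ _ _ _), pdList_smul L _ (contDiff_monoJapExp _ _ _ _)]
    simp only [Pi.add_apply, Pi.smul_apply, smul_eq_mul]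
    have hM : (0 : ℝ) ≤ (mfact α : ℝ) ^ s := by positivity
    have b₁ := (mul_le_mul_of_nonneg_left (h₁ L hL' (Function.update α j (α j - 1)) x)
      (Nat.cast_nonneg (α := ℝ) (α j))).trans (lowered_bound hs hq₁ α j)
    have b₂ := (mul_le_mul_of_nonneg_left (h₂ L hL' (Function.update α j (α j + 1)) x)
      (abs_nonneg t)).trans (raised_bound hs hq₂ α j)
    have b₃ := (mul_le_mul_of_nonneg_left (h₃ L hL' (Function.update α j (α j + 1)) x)
      (abs_nonneg (-(ε / s)))).trans (raised_bound hs hq₃ α j)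
    have hsum : a ^ (deg α + 1) + (b ^ (deg α + 1) + c ^ (deg α + 1)) ≤
        (a + (b + c)) ^ (deg α + 1) :=
      (add_le_add_right (pow_add_pow_le hb0 hc0 (Nat.succ_ne_zero _)) _).trans
        (pow_add_pow_le (by linarith) (by positivity) (Nat.succ_ne_zero _))
    refine le_trans ?_ (mul_le_mul_of_nonneg_right hsum hM)
    refine (abs_add_le _ _).trans ?_
    rw [add_mul, add_mul]
    refine add_le_add ?_ ((abs_add_le _ _).trans (add_le_add ?_ ?_))
    · rwa [abs_mul, Nat.abs_cast]
    · rwa [abs_mul]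
    · rwa [abs_mul]

end Bounds

/-- For `s, ε > 0` and `ν ∈ ℕ` there is `q > 0` such that for all
multi-indices `α`, all `β` with `|β| ≤ ν` and all `x ∈ ℝⁿ`,
`|∂^β(x^α e^{−ε⟨x⟩^{1/s}})(x)| ≤ q^{|α|+1} (α!)^s`. -/
theorem statement5 (n : ℕ) (hn : 1 ≤ n) (s ε : ℝ) (hs : 0 < s) (hε : 0 < ε) (ν : ℕ) :
    ∃ q : ℝ, 0 < q ∧ ∀ (α β : Fin n → ℕ), deg β ≤ ν → ∀ x : Euc n,
      |pdM β (fun y => (∏ i, y i ^ α i) * Real.exp (-ε * jap y ^ (1 / s))) x| ≤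
        q ^ (deg α + 1) * (mfact α : ℝ) ^ s := by
  choose q hq h using fun k => exists_bound_pdList n hs hε k 0
  have hq0 : ∀ k, 0 < q k := fun k => one_pos.trans_le (hq k)
  refine ⟨∑ k ∈ range (ν + 1), q k, Finset.sum_pos (fun k _ => hq0 k) (by simp),
    fun α β hβ x => ?_⟩
  obtain ⟨L, hL, hpd⟩ := exists_pdM_eq_pdList β
  have hf : (fun y : Euc n => (∏ i, y i ^ α i) * Real.exp (-ε * jap y ^ (1 / s))) =
      monoJapExp s ε α 0 := by
    ext y
    simp [monoJapExp]
  rw [hpd, hf]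
  refine (h _ L hL α x).trans ?_
  have hle : q (deg β) ≤ ∑ k ∈ range (ν + 1), q k :=
    Finset.single_le_sum (fun k _ => (hq0 k).le) (by simpa [Nat.lt_succ_iff] using hβ)
  have := (hq0 (deg β)).le
  gcongr
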